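/- arXiv:2004.00684 — 2 statements merged into one kernel-verified Lean document; each statement's English description precedes it below -/
import Mathlib

section
/- For every integer n ≥ 0, the number of lattice paths of length 2n that stay in the strip [-2, 1] and end at height -2 equals the Fibonacci number F(2n). -/
/-- The height of a lattice path `s : Fin n → ℤ` after `j` steps:
the sum of the first `j` steps. -/
def pathHeight {n : ℕ} (s : Fin n → ℤ) (j : ℕ) : ℤ :=
  ∑ i ∈ Finset.univ.filter (fun i : Fin n => (i : ℕ) < j), s i

/-- The number of lattice paths of length `n` (steps `±1`) whose height stays in
`[a, b]` at every time `0 ≤ j ≤ n` and whose final height lies in `E`. -/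
noncomputable def pathCount (n : ℕ) (a b : ℤ) (E : Set ℤ) : ℕ :=
  Nat.card {s : Fin n → ℤ //
    (∀ i, s i ∈ ({1, -1} : Set ℤ)) ∧
    (∀ j ≤ n, pathHeight s j ∈ Set.Icc a b) ∧
    pathHeight s n ∈ E}

/-- The lattice paths of length `n` that stay in the strip `[a, b]` and end at height `m`. -/
def stripPaths (n : ℕ) (a b m : ℤ) : Set (Fin n → ℤ) :=
  {s | (∀ i, s i ∈ ({1, -1} : Set ℤ)) ∧
    (∀ j ≤ n, pathHeight s j ∈ Set.Icc a b) ∧ pathHeight s n ∈ ({m} : Set ℤ)}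

theorem pathCount_singleton (n : ℕ) (a b m : ℤ) :
    pathCount n a b {m} = (stripPaths n a b m).ncard := rfl

theorem stripPaths_finite (n : ℕ) (a b m : ℤ) : (stripPaths n a b m).Finite :=
  (Set.Finite.pi' fun _ : Fin n => Set.toFinite ({1, -1} : Set ℤ)).subset fun _ hs => hs.1

theorem pathHeight_snoc_of_le {n : ℕ} (t : Fin n → ℤ) (x : ℤ) {j : ℕ} (hj : j ≤ n) :
    pathHeight (Fin.snoc t x : Fin (n + 1) → ℤ) j = pathHeight t j := by
  simp [pathHeight, Finset.sum_filter, Fin.sum_univ_castSucc, hj]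

theorem pathHeight_snoc_succ {n : ℕ} (t : Fin n → ℤ) (x : ℤ) :
    pathHeight (Fin.snoc t x : Fin (n + 1) → ℤ) (n + 1) = pathHeight t n + x := by
  simp [pathHeight, Finset.sum_filter, Fin.sum_univ_castSucc]

theorem snoc_mem_stripPaths {n : ℕ} {a b m x : ℤ} (hm : m ∈ Set.Icc a b) (t : Fin n → ℤ) :
    (Fin.snoc t x : Fin (n + 1) → ℤ) ∈ stripPaths (n + 1) a b m ↔
      x ∈ ({1, -1} : Set ℤ) ∧ t ∈ stripPaths n a b (m - x) := by
  have hsteps : (∀ i, (Fin.snoc t x : Fin (n + 1) → ℤ) i ∈ ({1, -1} : Set ℤ)) ↔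
      (∀ i, t i ∈ ({1, -1} : Set ℤ)) ∧ x ∈ ({1, -1} : Set ℤ) := by
    rw [Fin.forall_fin_succ']
    simp only [Fin.snoc_castSucc, Fin.snoc_last]
  simp only [stripPaths, Set.mem_ofPred_eq, hsteps, pathHeight_snoc_succ, Set.mem_singleton_iff]
  constructor
  · rintro ⟨⟨ht, hx⟩, hj, he⟩
    refine ⟨hx, ht, fun j hjn => ?_, by omega⟩
    rw [← pathHeight_snoc_of_le t x hjn]
    exact hj j (by omega)
  · rintro ⟨hx, ht, hj, he⟩
    refine ⟨⟨ht, hx⟩, fun j hjn => ?_, by omega⟩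
    rcases Nat.le_succ_iff.mp hjn with h | rfl
    · rw [pathHeight_snoc_of_le t x h]
      exact hj j h
    · rwa [pathHeight_snoc_succ, he, sub_add_cancel]

theorem stripPaths_succ {n : ℕ} {a b m : ℤ} (hm : m ∈ Set.Icc a b) :
    stripPaths (n + 1) a b m =
      (fun t => (Fin.snoc t 1 : Fin (n + 1) → ℤ)) '' stripPaths n a b (m - 1) ∪
        (fun t => (Fin.snoc t (-1) : Fin (n + 1) → ℤ)) '' stripPaths n a b (m + 1) := by
  ext s
  constructor
  · intro hs
    rw [← Fin.snoc_init_self s, snoc_mem_stripPaths hm] at hs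
    obtain ⟨hx | hx, ht⟩ := hs
    · rw [hx] at ht
      exact Or.inl ⟨_, ht, by simp only [← hx, Fin.snoc_init_self]⟩
    · rw [Set.mem_singleton_iff] at hx
      rw [hx, sub_neg_eq_add] at ht
      exact Or.inr ⟨_, ht, by simp only [← hx, Fin.snoc_init_self]⟩
  · rintro (⟨t, ht, rfl⟩ | ⟨t, ht, rfl⟩)
    · exact (snoc_mem_stripPaths hm t).2 ⟨by simp, ht⟩
    · exact (snoc_mem_stripPaths hm t).2 ⟨by simp, by rwa [sub_neg_eq_add]⟩

theorem snoc_left_injective {n : ℕ} (x : ℤ) :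
    Function.Injective fun t : Fin n → ℤ => (Fin.snoc t x : Fin (n + 1) → ℤ) := by
  intro s t h
  have h' := congrArg (fun u : Fin (n + 1) → ℤ => (Fin.init u : Fin n → ℤ)) h
  simpa only [Fin.init_snoc] using h'

theorem pathCount_succ (n : ℕ) {a b m : ℤ} (hm : m ∈ Set.Icc a b) :
    pathCount (n + 1) a b {m} = pathCount n a b {m - 1} + pathCount n a b {m + 1} := by
  simp only [pathCount_singleton]
  rw [stripPaths_succ hm, Set.ncard_union_eq _ ((stripPaths_finite ..).image _)
    ((stripPaths_finite ..).image _), Set.ncard_image_of_injective _ (snoc_left_injective 1),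
    Set.ncard_image_of_injective _ (snoc_left_injective (-1))]
  rw [Set.disjoint_left]
  rintro _ ⟨s, _, rfl⟩ ⟨t, _, h⟩
  have h' := congrFun h (Fin.last n)
  simp only [Fin.snoc_last] at h'
  omega

theorem pathCount_eq_zero (n : ℕ) {a b m : ℤ} (hm : m ∉ Set.Icc a b) :
    pathCount n a b {m} = 0 := by
  rw [pathCount_singleton, Set.ncard_eq_zero (stripPaths_finite ..),
    Set.eq_empty_iff_forall_notMem]
  rintro s ⟨_, hj, he⟩
  exact hm (Set.mem_singleton_iff.mp he ▸ hj n le_rfl)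

theorem pathCount_zero_of_ne {a b m : ℤ} (hm : m ≠ 0) : pathCount 0 a b {m} = 0 := by
  simp [pathCount, pathHeight, hm.symm]

theorem pathCount_zero_zero {a b : ℤ} (h : (0 : ℤ) ∈ Set.Icc a b) : pathCount 0 a b {0} = 1 := by
  have ha := h.1
  have hb := h.2
  simp [pathCount, pathHeight, ha, hb]

theorem pathCount_strip_eq_fib (n : ℕ) :
    pathCount (2 * n) (-2) 1 {-2} = Nat.fib (2 * n) ∧
      pathCount (2 * n) (-2) 1 {0} = Nat.fib (2 * n + 1) := by
  induction n with
  | zero => exact ⟨pathCount_zero_of_ne (by norm_num), pathCount_zero_zero (by norm_num)⟩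
  | succ n ih =>
    obtain ⟨h₂, h₀⟩ := ih
    have below : pathCount (2 * n + 1) (-2) 1 {-3} = 0 := pathCount_eq_zero _ (by norm_num)
    have above : pathCount (2 * n) (-2) 1 {2} = 0 := pathCount_eq_zero _ (by norm_num)
    have hm : pathCount (2 * n + 1) (-2) 1 {-1} = Nat.fib (2 * n + 2) := by
      rw [pathCount_succ _ (by norm_num), Nat.fib_add_two]
      norm_num [h₂, h₀]
    have hp : pathCount (2 * n + 1) (-2) 1 {1} = Nat.fib (2 * n + 1) := by
      rw [pathCount_succ _ (by norm_num)]
      norm_num [h₀, above]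
    constructor
    · rw [mul_add_one, pathCount_succ _ (by norm_num)]
      norm_num [below, hm]
    · rw [mul_add_one, pathCount_succ _ (by norm_num), Nat.fib_add_two (n := 2 * n + 1)]
      norm_num [hp, hm]
      exact Nat.add_comm _ _

theorem stmt_15 (n : ℕ) :
    pathCount (2 * n) (-2) 1 ({-2} : Set ℤ) = Nat.fib (2 * n) := by
  exact (pathCount_strip_eq_fib n).1
end

section
/- For every integer n ≥ 0, the number of lattice paths of length 2n+1 that stay in the strip [-2, 1] and end at height -1 is equal to the number of lattice paths of length 2n+2 that stay in the strip [0, 3] and end at height 2. -/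
@[simp]
theorem pathHeight_zero {n : ℕ} (s : Fin n → ℤ) : pathHeight s 0 = 0 := by
  simp [pathHeight]

theorem pathHeight_succ {n : ℕ} (s : Fin (n + 1) → ℤ) (j : ℕ) :
    pathHeight s (j + 1) = s 0 + pathHeight (fun i => s i.succ) j := by
  simp [pathHeight, Finset.sum_filter, Fin.sum_univ_succ]

theorem pathHeight_neg {n : ℕ} (s : Fin n → ℤ) (j : ℕ) :
    pathHeight (fun i => -s i) j = -pathHeight s j := by
  simp [pathHeight]

/-- Removing a forced initial up-step and reflecting the rest of the path. -/
theorem pathCount_succ_zero_eq_reflect (m : ℕ) {b : ℤ} (hb : 0 ≤ b) (E : Set ℤ) :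
    pathCount (m + 1) 0 b E = pathCount m (1 - b) 1 ((fun x => 1 - x) ⁻¹' E) := by
  have first_step (t : Fin (m + 1) → ℤ) (ht : ∀ i, t i ∈ ({1, -1} : Set ℤ))
      (hs : ∀ j ≤ m + 1, pathHeight t j ∈ Set.Icc 0 b) : t 0 = 1 := by
    have h := (hs (0 + 1) (by omega)).1
    rw [pathHeight_succ, pathHeight_zero] at h
    rcases ht 0 with h0 | h0
    · exact h0
    · rw [Set.mem_singleton_iff] at h0
      omega
  have height_tail (t : Fin (m + 1) → ℤ) (h0 : t 0 = 1) (j : ℕ) :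
      pathHeight (fun i => -t i.succ) j = 1 - pathHeight t (j + 1) := by
    rw [pathHeight_neg (fun i => t i.succ), pathHeight_succ, h0]
    ring
  have height_cons (s : Fin m → ℤ) (j : ℕ) :
      pathHeight (Fin.cons 1 (fun i => -s i) : Fin (m + 1) → ℤ) (j + 1) =
        1 - pathHeight s j := by
    simp [pathHeight_succ, pathHeight_neg, sub_eq_add_neg]
  refine Nat.card_congr
    { toFun := fun t => ⟨fun i => -t.1 i.succ, fun i => ?_, fun j hj => ?_, ?_⟩
      invFun := fun s => ⟨Fin.cons 1 (fun i => -s.1 i), fun i => ?_, fun j hj => ?_, ?_⟩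
      left_inv := fun t => ?_
      right_inv := fun s => ?_ }
  · rcases t.2.1 i.succ with h | h <;> simp_all
  · rw [height_tail _ (first_step _ t.2.1 t.2.2.1)]
    have h := t.2.2.1 (j + 1) (by omega)
    simp only [Set.mem_Icc] at h ⊢
    omega
  · rw [height_tail _ (first_step _ t.2.1 t.2.2.1)]
    simpa using t.2.2.2
  · refine Fin.cases (by simp) (fun k => ?_) i
    rcases s.2.1 k with h | h <;> simp_all
  · cases j with
    | zero => simpa using hb
    | succ j =>
      rw [height_cons]
      have h := s.2.2.1 j (by omega)
      simp only [Set.mem_Icc] at h ⊢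
      omega
  · rw [height_cons]
    exact s.2.2.2
  · ext i
    refine Fin.cases ?_ (fun k => by simp) i
    simp [first_step _ t.2.1 t.2.2.1]
  · ext i
    simp

theorem stmt_19 (n : ℕ) :
    pathCount (2 * n + 1) (-2) 1 ({-1} : Set ℤ) = pathCount (2 * n + 2) 0 3 ({2} : Set ℤ) := by
  rw [pathCount_succ_zero_eq_reflect (2 * n + 1) (by norm_num)]
  congr 1
  ext x
  simp only [Set.mem_singleton_iff, Set.mem_preimage]
  omega
end
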